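/- arXiv:2503.05216 — 3 statements merged into one kernel-verified Lean document; each statement's English description precedes it below -/
import Mathlib

section
/- Let m be a real number, let X be a finite set of real numbers, and let S = {q ∈ ℝ² : q_y ≤ m or q_x ∈ X}. Let h be a point of the Euclidean plane with h_y ≤ m, and let p : [0, 1] → ℝ² be a continuous path whose image is contained in S, whose starting point satisfies p(0)_y ≤ m, and for which the function s ↦ dist(h, p(s)) is antitone (nonincreasing). Then p(s)_y ≤ m for all s ∈ [0, 1]. -/
/-- Lemma 2 of the paper (formal core): in a region where the only routes strictly above the
horizontal line `y = m` are along finitely many vertical lines, a puppy that never increases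
its distance to a human at height at most `m`, and starts at height at most `m`, never rises
above `y = m`. -/
theorem puppy_stays_below_line (m : ℝ) (X : Finset ℝ)
    (h : EuclideanSpace ℝ (Fin 2)) (hh : h 1 ≤ m)
    (p : ℝ → EuclideanSpace ℝ (Fin 2))
    (hcont : ContinuousOn p (Set.Icc 0 1))
    (himg : ∀ s ∈ Set.Icc (0:ℝ) 1,
      p s ∈ {q : EuclideanSpace ℝ (Fin 2) | q 1 ≤ m ∨ q 0 ∈ X})
    (hstart : p 0 1 ≤ m)
    (hmono : AntitoneOn (fun s => dist h (p s)) (Set.Icc 0 1)) :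
    ∀ s ∈ Set.Icc (0:ℝ) 1, p s 1 ≤ m := by
  by_contra! hcon
  obtain ⟨s, hs, hms⟩ := hcon
  have hsub : Set.Icc 0 s ⊆ Set.Icc (0 : ℝ) 1 := Set.Icc_subset_Icc_right hs.2
  have hcoord (i : Fin 2) : ContinuousOn (fun t => p t i) (Set.Icc 0 1) := by fun_prop
  -- the last time `a` before `s` at which the path is not above the line
  have hclosed : IsClosed (Set.Icc 0 s ∩ (fun t => p t 1) ⁻¹' Set.Iic m) :=
    ((hcoord 1).mono hsub).preimage_isClosed_of_isClosed isClosed_Icc isClosed_Iic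
  obtain ⟨a, ⟨ha, ham⟩, hamax⟩ :=
    (isCompact_Icc.of_isClosed_subset hclosed Set.inter_subset_left).exists_isGreatest
      ⟨0, ⟨le_rfl, hs.1⟩, hstart⟩
  have has : a < s := lt_of_le_of_ne ha.2 fun he => by
    subst he
    exact absurd ham (not_le.2 hms)
  have hIcc : Set.Icc a s ⊆ Set.Icc (0 : ℝ) 1 := (Set.Icc_subset_Icc_left ha.1).trans hsub
  have habove : ∀ t ∈ Set.Ioc a s, m < p t 1 := fun t ht => by
    by_contra! hle
    exact absurd (hamax ⟨⟨ha.1.trans ht.1.le, ht.2⟩, hle⟩) (not_le.2 ht.1)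
  have hX : Set.MapsTo (fun t => p t 0) (Set.Ioc a s) (X : Set ℝ) := fun t ht =>
    (himg t (hIcc (Set.Ioc_subset_Icc_self ht))).resolve_left (not_le.2 (habove t ht))
  have hconst : ∀ t ∈ Set.Ioc a s, p t 0 = p s 0 := fun t ht =>
    isPreconnected_Ioc.constant_of_mapsTo X.finite_toSet.isDiscrete
      ((hcoord 0).mono (Set.Ioc_subset_Icc_self.trans hIcc)) hX ht ⟨has, le_rfl⟩
  have haX : p a 0 = p s 0 ∧ m ≤ p a 1 := by
    have hmem : Set.MapsTo (fun t => (p t 0, p t 1)) (Set.Ioc a s) ({p s 0} ×ˢ Set.Ici m) :=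
      fun t ht => ⟨hconst t ht, (habove t ht).le⟩
    have hclos := hmem.closure_of_continuousOn (by
      rw [closure_Ioc has.ne]
      exact ((hcoord 0).prodMk (hcoord 1)).mono hIcc)
    rw [closure_Ioc has.ne, (isClosed_singleton.prod isClosed_Ici).closure_eq] at hclos
    exact hclos (Set.left_mem_Icc.2 has.le)
  have hdist := hmono (hsub ha) hs has.le
  simp only [EuclideanSpace.dist_eq, Fin.sum_univ_two, Real.dist_eq, sq_abs] at hdist
  rw [Real.sqrt_le_sqrt_iff (by positivity), haX.1] at hdist
  have ham' : p a 1 ≤ m := ham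
  nlinarith [haX.2]
end

section
/- Let m and x₀ be real numbers, and let S = {q ∈ ℝ² : q_x ≤ x₀ or q_y = m}. Let h be a point of the Euclidean plane with first coordinate h_x ≤ x₀, and let p : [0, 1] → ℝ² be a continuous path whose image is contained in S, whose starting point satisfies p(0)_x ≤ x₀, and for which the function s ↦ dist(h, p(s)) is antitone (nonincreasing). Then p(s)_x ≤ x₀ for all s ∈ [0, 1]. -/
/-- Lemma 3 of the paper (formal core): in a region whose only escape to the right of the
vertical line `x = x₀` is along the horizontal line `y = m`, a puppy that never increases its
distance to a human located at abscissa at most `x₀`, and that starts at abscissa at most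
`x₀`, never moves to the right of `x = x₀`. -/
theorem puppy_stays_left (m x₀ : ℝ) (h : EuclideanSpace ℝ (Fin 2)) (hh : h 0 ≤ x₀)
    (p : ℝ → EuclideanSpace ℝ (Fin 2))
    (hcont : ContinuousOn p (Set.Icc 0 1))
    (himg : ∀ s ∈ Set.Icc (0:ℝ) 1,
      p s ∈ {q : EuclideanSpace ℝ (Fin 2) | q 0 ≤ x₀ ∨ q 1 = m})
    (hstart : p 0 0 ≤ x₀)
    (hmono : AntitoneOn (fun s => dist h (p s)) (Set.Icc 0 1)) :
    ∀ s ∈ Set.Icc (0:ℝ) 1, p s 0 ≤ x₀ := by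
  intro t ht
  by_contra! hlt
  have hcont_t : ContinuousOn p (Set.Icc 0 t) :=
    hcont.mono (Set.Icc_subset_Icc_right ht.2)
  have hclosed : IsClosed (Set.Icc 0 t ∩ p ⁻¹' {q | q 0 ≤ x₀}) :=
    hcont_t.preimage_isClosed_of_isClosed isClosed_Icc
      (isClosed_le (by fun_prop) continuous_const)
  have hcompact : IsCompact (Set.Icc 0 t ∩ p ⁻¹' {q | q 0 ≤ x₀}) :=
    isCompact_Icc.of_isClosed_subset hclosed Set.inter_subset_left
  -- `u` is the last time before `t` at which the path is not to the right of `x = x₀`.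
  obtain ⟨u, ⟨hu, hux⟩, hmax⟩ := hcompact.exists_isGreatest ⟨0, ⟨le_rfl, ht.1⟩, hstart⟩
  have hut : u < t := lt_of_le_of_ne hu.2 (by rintro rfl; exact hlt.not_ge hux)
  have hright : ∀ s ∈ Set.Ioc u t, x₀ < p s 0 := fun s hs => by
    by_contra! hle
    exact hs.1.not_ge (hmax ⟨⟨hu.1.trans hs.1.le, hs.2⟩, hle⟩)
  have hline : ∀ s ∈ Set.Ioc u t, p s 1 = m := fun s hs =>
    (himg s ⟨hu.1.trans hs.1.le, hs.2.trans ht.2⟩).resolve_left (hright s hs).not_ge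
  have hC : IsClosed {q : EuclideanSpace ℝ (Fin 2) | x₀ ≤ q 0 ∧ q 1 = m} :=
    IsClosed.and (isClosed_le continuous_const (by fun_prop))
      (isClosed_eq (by fun_prop) continuous_const)
  have hpu : x₀ ≤ p u 0 ∧ p u 1 = m := by
    have hmem := ((hcont_t u hu).mono (Set.Ioc_subset_Icc_self.trans
      (Set.Icc_subset_Icc_left hu.1))).mem_closure
      (by rw [closure_Ioc hut.ne]; exact Set.left_mem_Icc.2 hut.le)
      (t := {q : EuclideanSpace ℝ (Fin 2) | x₀ ≤ q 0 ∧ q 1 = m})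
      (fun s hs => ⟨(hright s hs).le, hline s hs⟩)
    exact hC.closure_subset hmem
  have hdist : dist h (p t) ≤ dist h (p u) := hmono ⟨hu.1, hu.2.trans ht.2⟩ ht hut.le
  have hsq := pow_le_pow_left₀ dist_nonneg hdist 2
  simp only [EuclideanSpace.dist_sq_eq, Fin.sum_univ_two, Real.dist_eq, sq_abs,
    hline t ⟨hut, le_rfl⟩, hpu.2, le_antisymm hux hpu.1] at hsq
  nlinarith
end

section
/- Let S¹ = {q ∈ ℝ² : ‖q‖ = 1} be the unit circle in the Euclidean plane, and let h and p be points of S¹. Suppose the configuration (h, p) is stable, that is, there exists ε > 0 such that every q ∈ S¹ with dist(p, q) ≤ ε satisfies dist(h, q) ≥ dist(h, p). Then p = h. -/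
/-- If `a * cos t + b * sin t` has a local maximum at `t = 0` and `(a, b)` lies on the unit circle,
then `a = 1`. -/
theorem eq_one_of_isLocalMax_cos_add_sin {a b : ℝ} (hab : a ^ 2 + b ^ 2 = 1)
    (hmax : IsLocalMax (fun t : ℝ ↦ a * Real.cos t + b * Real.sin t) 0) : a = 1 := by
  have hderiv : HasDerivAt (fun t : ℝ ↦ a * Real.cos t + b * Real.sin t) b 0 := by
    simpa using ((Real.hasDerivAt_cos 0).const_mul a).fun_add ((Real.hasDerivAt_sin 0).const_mul b)
  have hb : b = 0 := hmax.hasDerivAt_eq_zero hderiv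
  subst hb
  obtain ⟨δ, hδ, hball⟩ := Metric.eventually_nhds_iff.mp hmax
  have hpos : 0 < min (δ / 2) 1 := lt_min (by linarith) one_pos
  have hle := hball (y := min (δ / 2) 1) (by
    rw [Real.dist_eq, sub_zero, abs_of_pos hpos]
    linarith [min_le_left (δ / 2) 1])
  have hcos : Real.cos (min (δ / 2) 1) < Real.cos 0 :=
    Real.cos_lt_cos_of_nonneg_of_le_pi le_rfl
      (by linarith [min_le_right (δ / 2) 1, Real.pi_gt_three]) hpos
  simp only [Real.cos_zero, Real.sin_zero] at hle hcos
  nlinarith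

/-- On the unit circle, the only stable configuration is when the puppy is at the human's
position: if there is `ε > 0` such that no point of the circle within distance `ε` of the
puppy `p` is strictly closer to the human `h` than `p` is, then `p = h`. -/
theorem stable_on_unit_circle_eq (h p : EuclideanSpace ℝ (Fin 2))
    (hh : ‖h‖ = 1) (hp : ‖p‖ = 1)
    (hstable : ∃ ε > 0, ∀ q : EuclideanSpace ℝ (Fin 2), ‖q‖ = 1 →
      dist p q ≤ ε → dist h p ≤ dist h q) :
    p = h := by
  obtain ⟨ε, hε, hstable⟩ := hstable
  have hh' : h 0 ^ 2 + h 1 ^ 2 = 1 := by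
    simpa [hh] using (EuclideanSpace.real_norm_sq_eq h).symm
  have hp' : p 0 ^ 2 + p 1 ^ 2 = 1 := by
    simpa [hp] using (EuclideanSpace.real_norm_sq_eq p).symm
  let q : ℝ → EuclideanSpace ℝ (Fin 2) := fun t ↦
    !₂[Real.cos t * p 0 - Real.sin t * p 1, Real.cos t * p 1 + Real.sin t * p 0]
  have hq : Continuous q := by fun_prop
  have hq0 : q 0 = p := by
    ext i
    fin_cases i <;> simp [q]
  have hq_norm (t : ℝ) : ‖q t‖ = 1 := by
    rw [← sq_eq_sq₀ (norm_nonneg _) zero_le_one, EuclideanSpace.real_norm_sq_eq]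
    simp only [q, Fin.sum_univ_two, Matrix.cons_val_zero, Matrix.cons_val_one]
    linear_combination (Real.cos t ^ 2 + Real.sin t ^ 2) * hp' + Real.cos_sq_add_sin_sq t
  have hnear : ∀ᶠ t in nhds (0 : ℝ), dist p (q t) < ε :=
    (continuous_const.dist hq).continuousAt.eventually_lt_const (by simpa [hq0] using hε)
  have hmax : IsLocalMax (fun t : ℝ ↦ (h 0 * p 0 + h 1 * p 1) * Real.cos t +
      (h 1 * p 0 - h 0 * p 1) * Real.sin t) 0 := by
    filter_upwards [hnear] with t ht
    have hdist := hstable (q t) (hq_norm t) ht.le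
    rw [← sq_le_sq₀ dist_nonneg dist_nonneg, EuclideanSpace.dist_sq_eq,
      EuclideanSpace.dist_sq_eq] at hdist
    have hqt := EuclideanSpace.real_norm_sq_eq (q t)
    rw [hq_norm t] at hqt
    simp only [q, Fin.sum_univ_two, Real.dist_eq, sq_abs, Matrix.cons_val_zero,
      Matrix.cons_val_one] at hdist hqt
    simp only [Real.cos_zero, Real.sin_zero]
    linarith
  have hinner := eq_one_of_isLocalMax_cos_add_sin
    (by linear_combination (p 0 ^ 2 + p 1 ^ 2) * hh' + hp') hmax
  rw [← dist_eq_zero, ← sq_eq_zero_iff, EuclideanSpace.dist_sq_eq]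
  simp only [Fin.sum_univ_two, Real.dist_eq, sq_abs]
  linear_combination hh' + hp' - 2 * hinner
end
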